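/- Let the augmented matrix function Â(·) over V̂ = V ∪ {ω} be defined by â_ij = a_ij for i,j ∈ V, â_iω = d_i for i ∈ V, and â_ωj = 0 for all j ∈ V̂. Then: (i) if, for given measurable delays h_ij(t) ∈ [0,h̄], the damped averaging dynamics are asymptotically stable (every solution tends to 0), then the persistent graph of Â is quasi-strongly connected; (ii) if Â(·) satisfies the uniform local integrability assumption and is aperiodically quasi-strongly connected (AQSC), then for every h̄ ≥ 0 and all measurable delays h_ij(t) ∈ [0,h̄] the damped averaging dynamics are asymptotically stable. -/

import Mathlib

open MeasureTheory Filter Topology Set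

/-- There is a root node connected to every node by a directed walk. -/
def QSCrel {α : Type*} (r : α → α → Prop) : Prop :=
  ∃ root : α, ∀ i : α, Relation.ReflTransGen r root i

/-- The graph of the nonnegative matrix `B` (arc `(j,i)` iff `B i j > 0`), with all
entries smaller than `ε` zeroed out, is quasi-strongly connected. -/
def QSCeps {V : Type*} (ε : ℝ) (B : V → V → ℝ) : Prop :=
  QSCrel (fun u v : V => ε ≤ B v u)

variable {V : Type*} [Fintype V] [DecidableEq V]

/-- An increasing sequence of times tending to infinity, starting in `[0,∞)`. -/
def IncrSeq (tp : ℕ → ℝ) : Prop :=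
  StrictMono tp ∧ Tendsto tp atTop atTop ∧ 0 ≤ tp 0

/-- `(t_p)`-boundedness of the matrix function `A(⬝) = (a i j ⬝)`. -/
def tpBounded (a : V → V → ℝ → ℝ) (tp : ℕ → ℝ) : Prop :=
  ∃ L : ℝ, ∀ p : ℕ, ∀ i j : V, i ≠ j → (∫ s in (tp p)..(tp (p+1)), a i j s) ≤ L

/-- Aperiodic quasi-strong connectivity. -/
def AQSC (a : V → V → ℝ → ℝ) : Prop :=
  ∃ ε > (0:ℝ), ∃ tp : ℕ → ℝ, IncrSeq tp ∧ tpBounded a tp ∧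
    ∀ p : ℕ, QSCeps ε (fun i j => ∫ s in (tp p)..(tp (p+1)), a i j s)

/-- Non-instantaneous type-symmetry. -/
def NITS (a : V → V → ℝ → ℝ) : Prop :=
  ∃ K ≥ (1:ℝ), ∃ tp : ℕ → ℝ, IncrSeq tp ∧ tpBounded a tp ∧
    ∀ p : ℕ, ∀ i j : V,
      (1/K) * (∫ s in (tp p)..(tp (p+1)), a j i s) ≤ (∫ s in (tp p)..(tp (p+1)), a i j s) ∧
      (∫ s in (tp p)..(tp (p+1)), a i j s) ≤ K * (∫ s in (tp p)..(tp (p+1)), a j i s)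

/-- Uniform local integrability of the weights. -/
def ULI (a : V → V → ℝ → ℝ) : Prop :=
  ∀ D > (0:ℝ), ∃ M : ℝ, ∀ t ≥ (0:ℝ), ∀ i j : V, i ≠ j → (∫ s in t..(t+D), a i j s) ≤ M

/-- Admissible weights: measurable, nonnegative, locally integrable. -/
def Weights (a : V → V → ℝ → ℝ) : Prop :=
  ∀ i j : V, i ≠ j → Measurable (a i j) ∧ (∀ t ≥ (0:ℝ), 0 ≤ a i j t) ∧
    ∀ T : ℝ, IntegrableOn (a i j) (Icc 0 T)

/-- Admissible delays: measurable with values in `[0, h̄]`. -/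
def Delays (h : V → V → ℝ → ℝ) (hbar : ℝ) : Prop :=
  ∀ i j : V, Measurable (h i j) ∧ ∀ t ≥ (0:ℝ), h i j t ∈ Icc (0:ℝ) hbar

/-- Right-hand side of the delayed averaging dynamics. -/
def rhs (a h : V → V → ℝ → ℝ) (x : ℝ → V → ℝ) (i : V) (s : ℝ) : ℝ :=
  ∑ j ∈ Finset.univ.erase i, a i j s * (x (s - h i j s) j - x s i)

/-- A solution of the continuous-time delayed averaging algorithm with starting time `tstar`. -/
def IsSol (a h : V → V → ℝ → ℝ) (hbar tstar : ℝ) (x : ℝ → V → ℝ) : Prop :=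
  (∀ i : V, AEStronglyMeasurable (fun s => x s i) (volume.restrict (Icc (tstar - hbar) tstar))) ∧
  (∃ M : ℝ, ∀ s ∈ Icc (tstar - hbar) tstar, ∀ i : V, |x s i| ≤ M) ∧
  ∀ i : V, ∀ t ≥ tstar,
    IntervalIntegrable (rhs a h x i) volume tstar t ∧
    x t i = x tstar i + ∫ s in tstar..t, rhs a h x i s

/-- `Λ(t)`: supremum of the values over the window `[t-h̄, t]`. -/
noncomputable def Lam (hbar : ℝ) (x : ℝ → V → ℝ) (t : ℝ) : ℝ :=
  sSup {v | ∃ s ∈ Icc (t - hbar) t, ∃ i : V, x s i = v}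

/-- `λ(t)`: infimum of the values over the window `[t-h̄, t]`. -/
noncomputable def lam (hbar : ℝ) (x : ℝ → V → ℝ) (t : ℝ) : ℝ :=
  sInf {v | ∃ s ∈ Icc (t - hbar) t, ∃ i : V, x s i = v}

/-- Arc `(j,i)` of the persistent graph: `∫₀^∞ a i j = ∞`. -/
def PArc (a : V → V → ℝ → ℝ) (j i : V) : Prop :=
  j ≠ i ∧ (∫⁻ t in Ioi (0:ℝ), ENNReal.ofReal (a i j t)) = ⊤

/-- `i` and `j` are joined by a walk in the persistent graph. -/
def JoinedG (a : V → V → ℝ → ℝ) (i j : V) : Prop :=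
  Relation.ReflTransGen (fun u v => PArc a u v) i j

/-- Admissible damping gains. -/
def Gains (d : V → ℝ → ℝ) : Prop :=
  ∀ i : V, Measurable (d i) ∧ (∀ t ≥ (0:ℝ), 0 ≤ d i t) ∧
    ∀ T : ℝ, IntegrableOn (d i) (Icc 0 T)

/-- Right-hand side of the damped averaging dynamics. -/
def rhsDamp (a h : V → V → ℝ → ℝ) (d : V → ℝ → ℝ) (x : ℝ → V → ℝ) (i : V) (s : ℝ) : ℝ :=
  -(d i s * x s i) + ∑ j ∈ Finset.univ.erase i, a i j s * (x (s - h i j s) j - x s i)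

/-- A solution of the damped averaging dynamics. -/
def IsSolDamp (a h : V → V → ℝ → ℝ) (d : V → ℝ → ℝ) (hbar tstar : ℝ) (x : ℝ → V → ℝ) : Prop :=
  (∀ i : V, AEStronglyMeasurable (fun s => x s i) (volume.restrict (Icc (tstar - hbar) tstar))) ∧
  (∃ M : ℝ, ∀ s ∈ Icc (tstar - hbar) tstar, ∀ i : V, |x s i| ≤ M) ∧
  ∀ i : V, ∀ t ≥ tstar,
    IntervalIntegrable (rhsDamp a h d x i) volume tstar t ∧
    x t i = x tstar i + ∫ s in tstar..t, rhsDamp a h d x i s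

/-- The augmented matrix function over `V ∪ {ω}` (with `ω = none`). -/
def Ahat {V : Type*} (a : V → V → ℝ → ℝ) (d : V → ℝ → ℝ) :
    Option V → Option V → ℝ → ℝ
  | some i, some j => a i j
  | some i, none => d i
  | none, _ => fun _ => 0

lemma ac_exp_comp {C : ℝ → ℝ} {a b : ℝ} (hC : AbsolutelyContinuousOnInterval C a b) :
    AbsolutelyContinuousOnInterval (fun t => Real.exp (C t)) a b := by
  obtain ⟨B, hB⟩ := hC.exists_bound
  have key : ∀ x ∈ uIcc a b, ∀ y ∈ uIcc a b,
      dist (Real.exp (C x)) (Real.exp (C y)) ≤ Real.exp B * dist (C x) (C y) := by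
    have aux : ∀ u v : ℝ, u ≤ B → v ≤ u →
        |Real.exp u - Real.exp v| ≤ Real.exp B * |u - v| := by
      intro u v hu hv
      have h1 : Real.exp v ≤ Real.exp u := Real.exp_le_exp.2 hv
      rw [abs_of_nonneg (by linarith), abs_of_nonneg (by linarith)]
      have h2 : v - u + 1 ≤ Real.exp (v - u) := Real.add_one_le_exp _
      have h3 : Real.exp v = Real.exp u * Real.exp (v - u) := by
        rw [← Real.exp_add]; congr 1; ring
      have h4 : Real.exp u ≤ Real.exp B := Real.exp_le_exp.2 hu
      have h5 := Real.exp_pos u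
      calc Real.exp u - Real.exp v = Real.exp u * (1 - Real.exp (v-u)) := by rw [h3]; ring
        _ ≤ Real.exp u * (u - v) := by
            apply mul_le_mul_of_nonneg_left _ h5.le; linarith
        _ ≤ Real.exp B * (u - v) := by
            apply mul_le_mul_of_nonneg_right h4; linarith
    intro x hx y hy
    have h1 := hB x hx
    have h2 := hB y hy
    rw [Real.norm_eq_abs, abs_le] at h1 h2
    rw [Real.dist_eq, Real.dist_eq]
    rcases le_total (C y) (C x) with h | h
    · exact aux _ _ h1.2 h
    · rw [abs_sub_comm, abs_sub_comm (C x)]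
      exact aux _ _ h2.2 h
  rw [absolutelyContinuousOnInterval_iff] at hC ⊢
  intro ε hε
  have hE := Real.exp_pos B
  obtain ⟨δ, hδ, h⟩ := hC (ε / Real.exp B) (by positivity)
  refine ⟨δ, hδ, fun E hE1 hE2 => ?_⟩
  have h3 := h E hE1 hE2
  calc _ ≤ ∑ i ∈ Finset.range E.1, Real.exp B * dist (C (E.2 i).1) (C (E.2 i).2) := by
        apply Finset.sum_le_sum
        intro i hi
        have := hE1.1 i hi
        exact key _ this.1 _ this.2
    _ = Real.exp B * ∑ i ∈ Finset.range E.1, dist (C (E.2 i).1) (C (E.2 i).2) := by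
        rw [Finset.mul_sum]
    _ < Real.exp B * (ε / Real.exp B) := by gcongr
    _ = ε := by field_simp

lemma ac_const_add {u : ℝ → ℝ} {τ T : ℝ} (y0 : ℝ) (hu : IntervalIntegrable u volume τ T) :
    AbsolutelyContinuousOnInterval (fun t => y0 + ∫ s in τ..t, u s) τ T := by
  have h1 := hu.absolutelyContinuousOnInterval_intervalIntegral (c := τ) (by simp)
  have h2 : AbsolutelyContinuousOnInterval (fun _ : ℝ => y0) τ T := by
    apply ContDiffOn.absolutelyContinuousOnInterval
    exact contDiffOn_const
  exact h2.fun_add h1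

/-- Integrating factor identity. -/
lemma prod_identity {c u : ℝ → ℝ} {τ T : ℝ} (y0 : ℝ)
    (hc : IntervalIntegrable c volume τ T) (hu : IntervalIntegrable u volume τ T) :
    Real.exp (∫ s in τ..T, c s) * (y0 + ∫ s in τ..T, u s) = y0 +
      ∫ s in τ..T, Real.exp (∫ r in τ..s, c r) * (u s + c s * (y0 + ∫ r in τ..s, u r)) := by
  have hC := hc.absolutelyContinuousOnInterval_intervalIntegral (c := τ) (by simp)
  have hE := ac_exp_comp hC
  have hY := ac_const_add y0 hu
  have h := AbsolutelyContinuousOnInterval.integral_deriv_mul_eq_sub hE hY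
  simp only [intervalIntegral.integral_same, Real.exp_zero, add_zero, one_mul] at h
  rw [eq_comm, sub_eq_iff_eq_add] at h
  rw [h, add_comm]
  congr 1
  apply intervalIntegral.integral_congr_ae
  filter_upwards [hc.ae_hasDerivAt_integral, hu.ae_hasDerivAt_integral] with x h1 h2 hx
  have hx' := uIoc_subset_uIcc hx
  have d1 := (h1 hx' τ (by simp)).exp
  have d2 := (h2 hx' τ (by simp)).const_add y0
  rw [d1.deriv, d2.deriv]
  ring

lemma exp_identity {c : ℝ → ℝ} {τ T : ℝ} (hc : IntervalIntegrable c volume τ T) :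
    ∫ s in τ..T, c s * Real.exp (∫ r in τ..s, c r) = Real.exp (∫ s in τ..T, c s) - 1 := by
  have h := prod_identity (u := fun _ => 0) 1 hc (by simp)
  simp only [intervalIntegral.integral_zero, add_zero, mul_one, zero_add] at h
  rw [h]; simp [mul_comm]

lemma prim_continuousOn {c : ℝ → ℝ} {τ T : ℝ} (hc : IntervalIntegrable c volume τ T) :
    ContinuousOn (fun t => ∫ r in τ..t, c r) (uIcc τ T) :=
  (hc.absolutelyContinuousOnInterval_intervalIntegral (c := τ) (by simp)).continuousOn

lemma prim_mono {c : ℝ → ℝ} {τ s T : ℝ} (hs : τ ≤ s) (hT : s ≤ T)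
    (hc : IntervalIntegrable c volume τ T) (hc0 : ∀ r ∈ Icc τ T, 0 ≤ c r) :
    (∫ r in τ..s, c r) ≤ ∫ r in τ..T, c r := by
  apply intervalIntegral.integral_mono_interval le_rfl hs hT _ hc
  filter_upwards [ae_restrict_mem measurableSet_Ioc] with r hr
  exact hc0 r ⟨hr.1.le, hr.2⟩

/-- `y` solves `y' = - c y + f` on `[τ,T]`. -/
structure LinSol (c f y : ℝ → ℝ) (τ T : ℝ) : Prop where
  le : τ ≤ T
  hc : IntervalIntegrable c volume τ T
  hc0 : ∀ s ∈ Icc τ T, 0 ≤ c s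
  hf : IntervalIntegrable f volume τ T
  hcy : IntervalIntegrable (fun s => -(c s * y s) + f s) volume τ T
  eq : ∀ t ∈ Icc τ T, y t = y τ + ∫ s in τ..t, (-(c s * y s) + f s)

lemma LinSol.mild {c f y : ℝ → ℝ} {τ T : ℝ} (h : LinSol c f y τ T) :
    Real.exp (∫ s in τ..T, c s) * y T = y τ + ∫ s in τ..T, Real.exp (∫ r in τ..s, c r) * f s := by
  rw [h.eq T ⟨h.le, le_rfl⟩, prod_identity (y τ) h.hc h.hcy]
  congr 1
  apply intervalIntegral.integral_congr
  intro s hs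
  rw [uIcc_of_le h.le] at hs
  simp only
  rw [← h.eq s hs]
  ring

lemma LinSol.intE {c f y g : ℝ → ℝ} {τ T : ℝ} (h : LinSol c f y τ T)
    (hg : IntervalIntegrable g volume τ T) :
    IntervalIntegrable (fun s => Real.exp (∫ r in τ..s, c r) * g s) volume τ T :=
  hg.continuousOn_mul (Real.continuous_exp.comp_continuousOn (prim_continuousOn h.hc))

lemma LinSol.lower {c f y g : ℝ → ℝ} {τ T : ℝ} (h : LinSol c f y τ T)
    (hg : IntervalIntegrable g volume τ T) (hg0 : ∀ s ∈ Icc τ T, 0 ≤ g s)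
    (hgf : ∀ s ∈ Icc τ T, g s ≤ f s) :
    Real.exp (-∫ s in τ..T, c s) * (y τ + ∫ s in τ..T, g s) ≤ y T := by
  have hm := h.mild
  have h1 : ∫ s in τ..T, g s ≤ ∫ s in τ..T, Real.exp (∫ r in τ..s, c r) * f s := by
    apply intervalIntegral.integral_mono_on h.le hg (h.intE h.hf)
    intro s hs
    have h2 : 0 ≤ ∫ r in τ..s, c r :=
      intervalIntegral.integral_nonneg hs.1 (fun r hr => h.hc0 r ⟨hr.1, hr.2.trans hs.2⟩)
    have h3 : 1 ≤ Real.exp (∫ r in τ..s, c r) := Real.one_le_exp h2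
    have := hg0 s hs
    have := hgf s hs
    nlinarith
  have h4 : y T = Real.exp (-∫ s in τ..T, c s) * (Real.exp (∫ s in τ..T, c s) * y T) := by
    rw [← mul_assoc, ← Real.exp_add]; simp
  rw [h4, hm]
  gcongr

lemma LinSol.lower_neg {c f y g : ℝ → ℝ} {τ T : ℝ} (h : LinSol c f y τ T) (hy : 0 ≤ y τ)
    (hg : IntervalIntegrable g volume τ T) (hg0 : ∀ s ∈ Ioo τ T, 0 ≤ g s)
    (hgf : ∀ s ∈ Ioo τ T, - g s ≤ f s) :
    - ∫ s in τ..T, g s ≤ y T := by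
  have hm := h.mild
  have hE := Real.exp_pos (∫ s in τ..T, c s)
  have h1 : ∫ s in τ..T, (- (Real.exp (∫ s in τ..T, c s) * g s)) ≤
      ∫ s in τ..T, Real.exp (∫ r in τ..s, c r) * f s := by
    apply intervalIntegral.integral_mono_on_of_le_Ioo h.le (hg.const_mul _).neg (h.intE h.hf)
    intro s hs
    have h3 : Real.exp (∫ r in τ..s, c r) ≤ Real.exp (∫ r in τ..T, c r) :=
      Real.exp_le_exp.2 (prim_mono hs.1.le hs.2.le h.hc h.hc0)
    have h4 := Real.exp_pos (∫ r in τ..s, c r)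
    have := hg0 s hs
    have := hgf s hs
    simp only [Pi.neg_apply]
    nlinarith
  rw [intervalIntegral.integral_neg, intervalIntegral.integral_const_mul] at h1
  by_contra hcon
  push Not at hcon
  have := mul_lt_mul_of_pos_left hcon hE
  nlinarith

/-- Total outgoing rate of node `i`. -/
def cc (a : V → V → ℝ → ℝ) (d : V → ℝ → ℝ) (i : V) (s : ℝ) : ℝ :=
  d i s + ∑ j ∈ Finset.univ.erase i, a i j s

lemma Weights.ii {a : V → V → ℝ → ℝ} (hW : Weights a) {i j : V} (hij : i ≠ j) {τ T : ℝ}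
    (h0 : 0 ≤ τ) (h1 : τ ≤ T) : IntervalIntegrable (a i j) volume τ T := by
  rw [intervalIntegrable_iff_integrableOn_Icc_of_le h1]
  exact ((hW i j hij).2.2 T).mono_set (Icc_subset_Icc_left h0)

lemma Gains.ii {d : V → ℝ → ℝ} (hd : Gains d) (i : V) {τ T : ℝ}
    (h0 : 0 ≤ τ) (h1 : τ ≤ T) : IntervalIntegrable (d i) volume τ T := by
  rw [intervalIntegrable_iff_integrableOn_Icc_of_le h1]
  exact ((hd i).2.2 T).mono_set (Icc_subset_Icc_left h0)

lemma Weights.nonneg {a : V → V → ℝ → ℝ} (hW : Weights a) {i j : V}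
    (hj : j ∈ Finset.univ.erase i) {s : ℝ} (hs : 0 ≤ s) : 0 ≤ a i j s :=
  (hW i j (Finset.ne_of_mem_erase hj).symm).2.1 s hs

lemma cc_ii {a : V → V → ℝ → ℝ} (hW : Weights a) {d : V → ℝ → ℝ} (hd : Gains d) (i : V) {τ T : ℝ}
    (h0 : 0 ≤ τ) (h1 : τ ≤ T) : IntervalIntegrable (cc a d i) volume τ T := by
  apply (hd.ii i h0 h1).add
  have : (fun s => ∑ j ∈ Finset.univ.erase i, a i j s) = ∑ j ∈ Finset.univ.erase i, a i j := by
    ext s; simp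
  rw [this]
  apply IntervalIntegrable.sum
  intro j hj
  exact hW.ii (Finset.ne_of_mem_erase hj).symm h0 h1

lemma cc_nonneg {a : V → V → ℝ → ℝ} (hW : Weights a) {d : V → ℝ → ℝ} (hd : Gains d) (i : V) {s : ℝ}
    (hs : 0 ≤ s) : 0 ≤ cc a d i s :=
  add_nonneg ((hd i).2.1 s hs) (Finset.sum_nonneg fun _ hj => hW.nonneg hj hs)

lemma IsSolDamp.shift {a h : V → V → ℝ → ℝ} {d : V → ℝ → ℝ} {hbar tstar : ℝ} {x : ℝ → V → ℝ}
    (hx : IsSolDamp a h d hbar tstar x) (i : V) {τ t : ℝ} (h1 : tstar ≤ τ) (h2 : τ ≤ t) :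
    IntervalIntegrable (rhsDamp a h d x i) volume τ t ∧
      x t i = x τ i + ∫ s in τ..t, rhsDamp a h d x i s := by
  obtain ⟨A1, A2⟩ := hx.2.2 i t (h1.trans h2)
  obtain ⟨B1, B2⟩ := hx.2.2 i τ h1
  have hI : IntervalIntegrable (rhsDamp a h d x i) volume τ t := B1.symm.trans A1
  refine ⟨hI, ?_⟩
  rw [A2, B2, ← intervalIntegral.integral_add_adjacent_intervals B1 hI]
  ring

lemma IsSolDamp.cont {a h : V → V → ℝ → ℝ} {d : V → ℝ → ℝ} {hbar tstar : ℝ} {x : ℝ → V → ℝ}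
    (hx : IsSolDamp a h d hbar tstar x) (i : V) {τ T : ℝ} (h1 : tstar ≤ τ) (h2 : τ ≤ T) :
    ContinuousOn (fun t => x t i) (Icc τ T) := by
  have := (prim_continuousOn (hx.shift i h1 h2).1).const_add (x τ i)
  rw [uIcc_of_le h2] at this
  apply this.congr
  intro t ht
  exact (hx.shift i h1 ht.1).2

lemma IsSolDamp.neg {a h : V → V → ℝ → ℝ} {d : V → ℝ → ℝ} {hbar tstar : ℝ} {x : ℝ → V → ℝ}
    (hx : IsSolDamp a h d hbar tstar x) : IsSolDamp a h d hbar tstar (fun t i => - x t i) := by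
  have key : ∀ i, rhsDamp a h d (fun t i => - x t i) i = - rhsDamp a h d x i := by
    intro i; ext s
    simp only [rhsDamp, Pi.neg_apply, neg_add, ← Finset.sum_neg_distrib]
    congr 1
    · ring
    · apply Finset.sum_congr rfl; intro j _; ring
  refine ⟨fun i => (hx.1 i).neg, ?_, ?_⟩
  · obtain ⟨M, hM⟩ := hx.2.1
    exact ⟨M, fun s hs i => by simpa using hM s hs i⟩
  · intro i t ht
    obtain ⟨A, B⟩ := hx.2.2 i t ht
    rw [key]
    refine ⟨A.neg, ?_⟩
    simp only [Pi.neg_apply, intervalIntegral.integral_neg]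
    rw [B]; ring

/-- The forcing term for `M - x_i`. -/
def ff (a h : V → V → ℝ → ℝ) (d : V → ℝ → ℝ) (x : ℝ → V → ℝ) (M : ℝ) (i : V) (s : ℝ) : ℝ :=
  d i s * M + ∑ j ∈ Finset.univ.erase i, a i j s * (M - x (s - h i j s) j)

lemma IsSolDamp.lin {a h : V → V → ℝ → ℝ} (hW : Weights a) {d : V → ℝ → ℝ} (hd : Gains d)
    {hbar tstar : ℝ} {x : ℝ → V → ℝ} (h0 : 0 ≤ tstar)
    (hx : IsSolDamp a h d hbar tstar x) (M : ℝ) (i : V) {τ T : ℝ} (h1 : tstar ≤ τ) (h2 : τ ≤ T) :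
    LinSol (cc a d i) (ff a h d x M i) (fun s => M - x s i) τ T := by
  have key : ∀ s, -(cc a d i s * (M - x s i)) + ff a h d x M i s = - rhsDamp a h d x i s := by
    intro s
    simp only [cc, ff, rhsDamp, mul_sub, Finset.sum_sub_distrib, ← Finset.sum_mul]
    ring
  have hc := cc_ii hW hd i (h0.trans h1) h2
  have hr := (hx.shift i h1 h2).1
  refine ⟨h2, hc, fun s hs => cc_nonneg hW hd i (by linarith [hs.1]), ?_, ?_, ?_⟩
  · have e : ff a h d x M i = fun s => cc a d i s * (M - x s i) - rhsDamp a h d x i s := by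
      ext s; linarith [key s]
    rw [e]
    apply IntervalIntegrable.sub _ hr
    apply hc.mul_continuousOn
    rw [uIcc_of_le h2]
    exact continuousOn_const.sub (hx.cont i h1 h2)
  · simp_rw [key]; exact hr.neg
  · intro t ht
    simp_rw [key]
    rw [intervalIntegral.integral_neg, (hx.shift i h1 ht.1).2]
    ring

lemma max_principle {a h : V → V → ℝ → ℝ} (hW : Weights a) {d : V → ℝ → ℝ} (hd : Gains d)
    {hbar tstar : ℝ} {x : ℝ → V → ℝ} (h0 : 0 ≤ tstar) (hh : Delays h hbar)
    (hx : IsSolDamp a h d hbar tstar x) {M : ℝ} (hM : 0 ≤ M) {τ : ℝ} (h1 : tstar ≤ τ)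
    (hle : ∀ s ∈ Icc (τ - hbar) τ, ∀ j, x s j ≤ M) :
    ∀ t ≥ τ, ∀ i, x t i ≤ M := by
  set b : ℝ → ℝ := fun s => ∑ i, cc a d i s with hb
  have hτ : 0 ≤ τ := h0.trans h1
  have hbi : ∀ T, τ ≤ T → IntervalIntegrable b volume τ T := by
    intro T hT
    have : b = ∑ i, cc a d i := by ext s; simp [hb]
    rw [this]
    exact IntervalIntegrable.sum _ (fun i _ => cc_ii hW hd i hτ hT)
  have hb0 : ∀ s, 0 ≤ s → 0 ≤ b s := fun s hs => Finset.sum_nonneg fun i _ => cc_nonneg hW hd i hs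
  have main : ∀ δ > (0:ℝ), ∀ t ≥ τ, ∀ i, x t i < M + δ * Real.exp (∫ s in τ..t, b s) := by
    intro δ hδ t ht i
    by_contra hcon
    push Not at hcon
    set Z : Set ℝ := {r | r ∈ Icc τ t ∧ ∃ i, M + δ * Real.exp (∫ s in τ..r, b s) ≤ x r i} with hZ
    have hZne : Z.Nonempty := ⟨t, ⟨ht, le_rfl⟩, i, hcon⟩
    have hZc : IsClosed Z := by
      have : Z = ⋃ i, {r | r ∈ Icc τ t ∧ M + δ * Real.exp (∫ s in τ..r, b s) ≤ x r i} := by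
        ext r; simp [hZ]
      rw [this]
      apply isClosed_iUnion_of_finite
      intro i
      apply isClosed_Icc.isClosed_le
      · have := prim_continuousOn (hbi t ht)
        rw [uIcc_of_le ht] at this
        exact continuousOn_const.add (continuousOn_const.mul (Real.continuous_exp.comp_continuousOn this))
      · exact hx.cont i h1 ht
    have hZb : BddBelow Z := ⟨τ, fun r hr => hr.1.1⟩
    obtain ⟨⟨g1, g2⟩, k, hk⟩ := hZc.csInf_mem hZne hZb
    set r := sInf Z with hr
    have hlt : ∀ s, τ ≤ s → s < r → ∀ j, x s j < M + δ * Real.exp (∫ u in τ..s, b u) := by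
      intro s hs hsr j
      by_contra hc
      push Not at hc
      have : s ∈ Z := ⟨⟨hs, hsr.le.trans g2⟩, j, hc⟩
      exact absurd (csInf_le hZb this) (not_le.2 hsr)
    have hlin := hx.lin hW hd h0 M k h1 g1
    have hAc := prim_continuousOn (hbi r g1)
    have hres := hlin.lower_neg (g := fun s => δ * (b s * Real.exp (∫ u in τ..s, b u)))
      (by have := hle τ ⟨by have := (hh k k).2 0 le_rfl; linarith [this.1, this.2], le_rfl⟩ k
          linarith)
      (((hbi r g1).mul_continuousOn (Real.continuous_exp.comp_continuousOn hAc)).const_mul δ)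
      (by intro s hs
          have := hb0 s (hτ.trans hs.1.le)
          positivity)
      (by
        intro s hs
        have hs0 : 0 ≤ s := hτ.trans hs.1.le
        have e1 : ∀ j, - (δ * Real.exp (∫ u in τ..s, b u)) ≤ M - x (s - h k j s) j := by
          intro j
          have hd1 := (hh k j).2 s hs0
          have hpos : 0 < δ * Real.exp (∫ u in τ..s, b u) := by positivity
          rcases le_total τ (s - h k j s) with hc | hc
          · have e2 := hlt _ hc (by linarith [hd1.1, hs.2]) j
            have e3 : (∫ u in τ..(s - h k j s), b u) ≤ ∫ u in τ..s, b u :=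
              prim_mono hc (by linarith [hd1.1]) (hbi s hs.1.le) (fun u hu => hb0 u (hτ.trans hu.1))
            have e4 := mul_le_mul_of_nonneg_left (Real.exp_le_exp.2 e3) hδ.le
            linarith
          · have := hle (s - h k j s) ⟨by linarith [hd1.2, hs.1], hc⟩ j
            linarith
        set E := δ * Real.exp (∫ u in τ..s, b u) with hE
        have hE0 : 0 < E := by positivity
        have e5 : ∑ j ∈ Finset.univ.erase k, a k j s * (- E) ≤
            ∑ j ∈ Finset.univ.erase k, a k j s * (M - x (s - h k j s) j) :=
          Finset.sum_le_sum fun j hj => mul_le_mul_of_nonneg_left (e1 j) (hW.nonneg hj hs0)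
        rw [← Finset.sum_mul] at e5
        have e6 : ∑ j ∈ Finset.univ.erase k, a k j s ≤ b s := by
          have e7 : cc a d k s ≤ b s :=
            Finset.single_le_sum (f := fun i => cc a d i s) (fun i _ => cc_nonneg hW hd i hs0)
              (Finset.mem_univ k)
          have := (hd k).2.1 s hs0
          simp only [cc] at e7
          linarith
        have e8 := mul_nonneg ((hd k).2.1 s hs0) hM
        have e9 : δ * (b s * Real.exp (∫ u in τ..s, b u)) = b s * E := by rw [hE]; ring
        simp only [ff]
        rw [e9]
        nlinarith)
    rw [intervalIntegral.integral_const_mul, exp_identity (hbi r g1)] at hres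
    nlinarith
  intro t ht i
  by_contra hcon
  push Not at hcon
  have hE := Real.exp_pos (∫ s in τ..t, b s)
  have := main ((x t i - M) / Real.exp (∫ s in τ..t, b s)) (div_pos (by linarith) hE) t ht i
  rw [div_mul_cancel₀ _ hE.ne'] at this
  linarith

lemma cc_int_le {a : V → V → ℝ → ℝ} (hW : Weights a) {d : V → ℝ → ℝ} (hd : Gains d) (i : V)
    {τ T B : ℝ} (h0 : 0 ≤ τ) (h1 : τ ≤ T) (hB : 0 ≤ B)
    (hb : ∀ i j : Option V, i ≠ j → (∫ s in τ..T, Ahat a d i j s) ≤ B) :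
    ∫ s in τ..T, cc a d i s ≤ (1 + Fintype.card V) * B := by
  have e1 : ∫ s in τ..T, cc a d i s = (∫ s in τ..T, d i s) +
      ∑ j ∈ Finset.univ.erase i, ∫ s in τ..T, a i j s := by
    simp only [cc]
    rw [intervalIntegral.integral_add (hd.ii i h0 h1), intervalIntegral.integral_finsetSum]
    · intro j hj
      exact hW.ii (Finset.ne_of_mem_erase hj).symm h0 h1
    · have : (fun s => ∑ j ∈ Finset.univ.erase i, a i j s) = ∑ j ∈ Finset.univ.erase i, a i j := by
        ext s; simp
      rw [this]
      apply IntervalIntegrable.sum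
      intro j hj
      exact hW.ii (Finset.ne_of_mem_erase hj).symm h0 h1
  have e2 : (∫ s in τ..T, d i s) ≤ B := hb (some i) none (by simp)
  have e3 : ∑ j ∈ Finset.univ.erase i, ∫ s in τ..T, a i j s ≤ ∑ j ∈ Finset.univ.erase i, B := by
    apply Finset.sum_le_sum
    intro j hj
    exact hb (some i) (some j) (by simpa using (Finset.ne_of_mem_erase hj).symm)
  have e4 : ∑ j ∈ Finset.univ.erase i, B ≤ ∑ j : V, B :=
    Finset.sum_le_sum_of_subset_of_nonneg (Finset.erase_subset _ _) (fun _ _ _ => hB)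
  rw [show ∑ j : V, B = Fintype.card V * B by simp] at e4
  linarith

lemma exists_p {a : V → V → ℝ → ℝ} (hW : Weights a) {d : V → ℝ → ℝ} (hd : Gains d)
    (hU : ULI (Ahat a d)) {tp : ℕ → ℝ} (htp : IncrSeq tp) (hbd : tpBounded (Ahat a d) tp)
    {hbar : ℝ} (hh : 0 ≤ hbar) :
    ∃ K : ℝ, 0 ≤ K ∧ ∀ τ ≥ tp 0, ∃ p, τ + hbar ≤ tp p ∧
      ∀ i, ∫ s in τ..tp (p+1), cc a d i s ≤ K := by
  obtain ⟨M, hM⟩ := hU (hbar + 1) (by linarith)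
  obtain ⟨L, hL⟩ := hbd
  obtain ⟨hmono, htend, h0⟩ := htp
  refine ⟨(1 + Fintype.card V) * |M| + 2 * ((1 + Fintype.card V) * |L|), by positivity, ?_⟩
  intro τ hτ
  have hτ0 : 0 ≤ τ := h0.trans hτ
  have hex : ∃ p, τ + hbar ≤ tp (p+1) := by
    obtain ⟨p, hp⟩ := (htend.eventually_ge_atTop (τ + hbar)).exists
    exact ⟨p, hp.trans (hmono.monotone (Nat.le_succ p))⟩
  classical
  obtain ⟨q, hq1, hq2⟩ : ∃ q, τ + hbar ≤ tp (q+1) ∧ tp q ≤ τ + hbar := by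
    refine ⟨Nat.find hex, Nat.find_spec hex, ?_⟩
    rcases hq : Nat.find hex with _ | m
    · linarith
    · have := Nat.find_min hex (m := m) (by omega)
      push Not at this
      exact this.le
  refine ⟨q + 1, hq1, fun i => ?_⟩
  have hpos : ∀ p, 0 ≤ tp p := fun p => h0.trans (hmono.monotone (Nat.zero_le p))
  have hle : ∀ p, tp p ≤ tp (p+1) := fun p => hmono.monotone (Nat.le_succ p)
  have b1 : ∫ s in τ..(τ + (hbar + 1)), cc a d i s ≤ (1 + Fintype.card V) * |M| :=
    cc_int_le hW hd i hτ0 (by linarith) (abs_nonneg M)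
      (fun i j hij => (hM τ hτ0 i j hij).trans (le_abs_self M))
  have b2 : ∀ p, ∫ s in (tp p)..(tp (p+1)), cc a d i s ≤ (1 + Fintype.card V) * |L| := fun p =>
    cc_int_le hW hd i (hpos p) (hle p) (abs_nonneg L)
      (fun i j hij => (hL p i j hij).trans (le_abs_self L))
  have c1 : ∫ s in τ..(τ + hbar), cc a d i s ≤ ∫ s in τ..(τ + (hbar + 1)), cc a d i s :=
    prim_mono (by linarith) (by linarith) (cc_ii hW hd i hτ0 (by linarith))
      (fun s hs => cc_nonneg hW hd i (hτ0.trans hs.1))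
  have c2 : ∫ s in (τ + hbar)..tp (q+1), cc a d i s ≤ ∫ s in (tp q)..tp (q+1), cc a d i s := by
    apply intervalIntegral.integral_mono_interval hq2 hq1 le_rfl _ (cc_ii hW hd i (hpos q) (hle q))
    filter_upwards [ae_restrict_mem measurableSet_Ioc] with r hr
    exact cc_nonneg hW hd i ((hpos q).trans hr.1.le)
  have i1 := cc_ii hW hd i hτ0 (show τ ≤ τ + hbar by linarith)
  have i2 := cc_ii hW hd i (show 0 ≤ τ + hbar by linarith) hq1
  have i3 := cc_ii hW hd i (hpos (q+1)) (hle (q+1))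
  rw [← intervalIntegral.integral_add_adjacent_intervals (i1.trans i2) i3,
    ← intervalIntegral.integral_add_adjacent_intervals i1 i2]
  linarith [b2 q, b2 (q+1)]

lemma cross_arc {α : Type*} {r : α → α → Prop} {u v : α} (h : Relation.ReflTransGen r u v)
    (P : α → Prop) (hu : P u) (hv : ¬ P v) : ∃ s t, r s t ∧ P s ∧ ¬ P t := by
  induction h with
  | refl => exact absurd hu hv
  | tail h1 h2 ih =>
    rename_i b c
    by_cases hb : P b
    · exact ⟨b, c, h2, hb, hv⟩
    · exact ih hb

lemma new_node {a : V → V → ℝ → ℝ} {d : V → ℝ → ℝ} {ε τ T : ℝ} (hε : 0 < ε)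
    (hq : QSCeps ε (fun i j => ∫ s in τ..T, Ahat a d i j s)) (R : Finset V) (hR : R ≠ Finset.univ) :
    ∃ i, i ∉ R ∧ ((ε ≤ ∫ s in τ..T, d i s) ∨ ∃ j ∈ R, ε ≤ ∫ s in τ..T, a i j s) := by
  obtain ⟨root, hroot⟩ := hq
  have hno : ∀ u : Option V, ¬ (ε ≤ ∫ s in τ..T, Ahat a d none u s) := by
    intro u
    simp only [Ahat, intervalIntegral.integral_zero]
    linarith
  have hr : root = none := by
    rcases Relation.ReflTransGen.cases_tail (hroot none) with h | ⟨b, _, hb⟩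
    · exact h.symm
    · exact absurd hb (hno b)
  subst hr
  obtain ⟨i, hi⟩ : ∃ i, i ∉ R := by
    by_contra hcon
    push Not at hcon
    exact hR (Finset.eq_univ_iff_forall.2 hcon)
  obtain ⟨u, v, huv, hu, hv⟩ := cross_arc (hroot (some i)) (fun o => ∀ j, o = some j → j ∈ R)
    (by simp) (by simpa using hi)
  push Not at hv
  obtain ⟨k, rfl, hk⟩ := hv
  refine ⟨k, hk, ?_⟩
  cases u with
  | none => exact Or.inl huv
  | some j => exact Or.inr ⟨j, hu j rfl, huv⟩

/-- Basic decay estimate. -/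
lemma keep {a h : V → V → ℝ → ℝ} (hW : Weights a) {d : V → ℝ → ℝ} (hd : Gains d)
    {hbar tstar : ℝ} {x : ℝ → V → ℝ} (h0 : 0 ≤ tstar) (hh : Delays h hbar)
    (hx : IsSolDamp a h d hbar tstar x) {M : ℝ} (hM : 0 ≤ M) {τ T K : ℝ} (h1 : tstar ≤ τ)
    (hT : τ ≤ T)
    (hle : ∀ s ≥ τ - hbar, ∀ j, x s j ≤ M) (i : V) (hK : ∫ s in τ..T, cc a d i s ≤ K)
    (g : ℝ → ℝ) (hg : IntervalIntegrable g volume τ T) (hg0 : ∀ s ∈ Icc τ T, 0 ≤ g s)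
    (hgf : ∀ s ∈ Icc τ T, g s ≤ ff a h d x M i s) (hbar0 : 0 ≤ hbar) :
    Real.exp (-K) * (M - x τ i + ∫ s in τ..T, g s) ≤ M - x T i := by
  refine le_trans ?_ ((hx.lin hW hd h0 M i h1 hT).lower hg hg0 hgf)
  have e1 := hle τ (by linarith) i
  have e2 := intervalIntegral.integral_nonneg (μ := volume) hT hg0
  apply mul_le_mul_of_nonneg_right _ (by linarith)
  apply Real.exp_le_exp.2
  linarith

lemma ff_nonneg {a h : V → V → ℝ → ℝ} (hW : Weights a) {d : V → ℝ → ℝ} (hd : Gains d)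
    {hbar : ℝ} {x : ℝ → V → ℝ} (hh : Delays h hbar) {M : ℝ} (hM : 0 ≤ M) {τ s : ℝ} (hs : 0 ≤ s)
    (hτ : τ ≤ s) (hle : ∀ s ≥ τ - hbar, ∀ j, x s j ≤ M) (i : V) :
    0 ≤ ff a h d x M i s := by
  apply add_nonneg (mul_nonneg ((hd i).2.1 s hs) hM)
  apply Finset.sum_nonneg
  intro j hj
  apply mul_nonneg (hW.nonneg hj hs)
  have := ((hh i j).2 s hs).2
  linarith [hle (s - h i j s) (by linarith) j]

lemma ff_ge_d {a h : V → V → ℝ → ℝ} (hW : Weights a) {d : V → ℝ → ℝ}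
    {hbar : ℝ} {x : ℝ → V → ℝ} (hh : Delays h hbar) {M : ℝ} {τ s : ℝ} (hs : 0 ≤ s)
    (hτ : τ ≤ s) (hle : ∀ s ≥ τ - hbar, ∀ j, x s j ≤ M) (i : V) :
    d i s * M ≤ ff a h d x M i s := by
  apply le_add_of_nonneg_right
  apply Finset.sum_nonneg
  intro j hj
  apply mul_nonneg (hW.nonneg hj hs)
  have := ((hh i j).2 s hs).2
  linarith [hle (s - h i j s) (by linarith) j]

lemma ff_ge_a {a h : V → V → ℝ → ℝ} (hW : Weights a) {d : V → ℝ → ℝ} (hd : Gains d)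
    {hbar : ℝ} {x : ℝ → V → ℝ} (hh : Delays h hbar) {M : ℝ} (hM : 0 ≤ M) {τ s : ℝ} (hs : 0 ≤ s)
    (hτ : τ ≤ s) (hle : ∀ s ≥ τ - hbar, ∀ j, x s j ≤ M) {i j : V} (hij : j ≠ i) :
    a i j s * (M - x (s - h i j s) j) ≤ ff a h d x M i s := by
  have h1 := mul_nonneg ((hd i).2.1 s hs) hM
  have h2 : a i j s * (M - x (s - h i j s) j) ≤
      ∑ j ∈ Finset.univ.erase i, a i j s * (M - x (s - h i j s) j) := by
    apply Finset.single_le_sum (f := fun j => a i j s * (M - x (s - h i j s) j)) _ (by simp [hij])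
    intro j hj
    apply mul_nonneg (hW.nonneg hj hs)
    have := ((hh i j).2 s hs).2
    linarith [hle (s - h i j s) (by linarith) j]
  simp only [ff]
  linarith

lemma stage {a h : V → V → ℝ → ℝ} (hW : Weights a) {d : V → ℝ → ℝ} (hd : Gains d)
    {hbar tstar : ℝ} {x : ℝ → V → ℝ} (h0 : 0 ≤ tstar) (hh : Delays h hbar) (hbar0 : 0 ≤ hbar)
    (hx : IsSolDamp a h d hbar tstar x) {M : ℝ} (hM : 0 ≤ M) {τ K ε : ℝ} (h1 : tstar ≤ τ)
    (hle : ∀ s ≥ τ - hbar, ∀ j, x s j ≤ M) (hε : 0 < ε) (hK0 : 0 ≤ K)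
    {t1 t2 : ℝ} (ht1 : τ + hbar ≤ t1) (ht2 : t1 ≤ t2)
    (hK : ∀ i, ∫ s in τ..t2, cc a d i s ≤ K)
    (hq : QSCeps ε (fun i j => ∫ s in t1..t2, Ahat a d i j s))
    (R : Finset V) (hR : R ≠ Finset.univ) {η : ℝ} (hη : 0 ≤ η) (hηM : η ≤ M)
    (hgood : ∀ i ∈ R, η ≤ M - x τ i) :
    ∃ i, i ∉ R ∧ ∀ k ∈ insert i R,
      Real.exp (-K) * Real.exp (-K) * min ε 1 * η ≤ M - x t2 k := by
  have hτ0 : 0 ≤ τ := h0.trans h1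
  have hE := Real.exp_pos (-K)
  have hE1 : Real.exp (-K) ≤ 1 := Real.exp_le_one_iff.2 (by linarith)
  have hmin : 0 < min ε 1 := lt_min hε one_pos
  have hm1 : min ε 1 ≤ 1 := min_le_right _ _
  have hm2 : min ε 1 ≤ ε := min_le_left _ _
  have hKs : ∀ i, ∀ T, τ ≤ T → T ≤ t2 → ∫ s in τ..T, cc a d i s ≤ K := by
    intro i T hT1 hT2
    exact (prim_mono hT1 hT2 (cc_ii hW hd i hτ0 (by linarith))
      (fun s hs => cc_nonneg hW hd i (hτ0.trans hs.1))).trans (hK i)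
  have hold : ∀ j ∈ R, ∀ T, τ ≤ T → T ≤ t2 → Real.exp (-K) * η ≤ M - x T j := by
    intro j hj T hT1 hT2
    have := keep hW hd h0 hh hx hM h1 hT1 hle j (hKs j T hT1 hT2) (fun _ => 0) (by simp)
      (by simp) (fun s hs => ff_nonneg hW hd hh hM (hτ0.trans hs.1) hs.1 hle j) hbar0
    simp only [intervalIntegral.integral_zero, add_zero] at this
    exact (mul_le_mul_of_nonneg_left (hgood j hj) hE.le).trans this
  have hle' : ∀ s ≥ t1 - hbar, ∀ j, x s j ≤ M := fun s hs j => hle s (by linarith) j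
  have hK' : ∀ i, ∫ s in t1..t2, cc a d i s ≤ K := by
    intro i
    refine le_trans ?_ (hK i)
    apply intervalIntegral.integral_mono_interval (by linarith) ht2 le_rfl _
      (cc_ii hW hd i hτ0 (by linarith))
    filter_upwards [ae_restrict_mem measurableSet_Ioc] with r hr
    exact cc_nonneg hW hd i (hτ0.trans hr.1.le)
  have ht10 : 0 ≤ t1 := by linarith
  obtain ⟨i, hi, hcase⟩ := new_node hε hq R hR
  refine ⟨i, hi, fun k hk => ?_⟩
  have hEη : 0 ≤ Real.exp (-K) * η := by positivity
  rcases Finset.mem_insert.1 hk with rfl | hk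
  · have hx1 := hle' t1 (by linarith) k
    rcases hcase with hc | ⟨j, hj, hc⟩
    · have := keep hW hd h0 hh hx hM (by linarith) ht2 hle' k (hK' k) (fun s => d k s * M)
        ((hd.ii k ht10 ht2).mul_const M)
        (fun s hs => mul_nonneg ((hd k).2.1 s (ht10.trans hs.1)) hM)
        (fun s hs => ff_ge_d hW hh (ht10.trans hs.1) hs.1 hle' k) hbar0
      rw [intervalIntegral.integral_mul_const] at this
      refine le_trans ?_ this
      have e1 : min ε 1 * η ≤ (∫ s in t1..t2, d k s) * M := by
        apply mul_le_mul (hm2.trans hc) hηM hη (hε.le.trans hc)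
      have e2 : Real.exp (-K) * (min ε 1 * η) ≤ 1 * (min ε 1 * η) :=
        mul_le_mul_of_nonneg_right hE1 (by positivity)
      rw [mul_assoc, mul_assoc]
      apply mul_le_mul_of_nonneg_left _ hE.le
      linarith
    · have hjk : j ≠ k := fun e => hi (e ▸ hj)
      have := keep hW hd h0 hh hx hM (by linarith) ht2 hle' k (hK' k)
        (fun s => a k j s * (Real.exp (-K) * η))
        ((hW.ii hjk.symm ht10 ht2).mul_const _)
        (fun s hs => mul_nonneg ((hW k j hjk.symm).2.1 s (ht10.trans hs.1)) hEη)
        (fun s hs => by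
          have hs0 := ht10.trans hs.1
          refine le_trans ?_ (ff_ge_a hW hd hh hM hs0 hs.1 hle' hjk)
          apply mul_le_mul_of_nonneg_left _ ((hW k j hjk.symm).2.1 s hs0)
          have hd1 := (hh k j).2 s hs0
          exact hold j hj _ (by linarith [hd1.2, hs.1]) (by linarith [hd1.1, hs.2])) hbar0
      rw [intervalIntegral.integral_mul_const] at this
      refine le_trans ?_ this
      have e1 : min ε 1 * (Real.exp (-K) * η) ≤ (∫ s in t1..t2, a k j s) * (Real.exp (-K) * η) :=
        mul_le_mul_of_nonneg_right (hm2.trans hc) hEη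
      have e3 : Real.exp (-K) * Real.exp (-K) * min ε 1 * η =
        Real.exp (-K) * (min ε 1 * (Real.exp (-K) * η)) := by ring
      rw [e3]
      apply mul_le_mul_of_nonneg_left _ hE.le
      linarith
  · refine le_trans ?_ (hold k hk t2 (by linarith) le_rfl)
    have e3 : Real.exp (-K) * Real.exp (-K) * min ε 1 * η =
        (Real.exp (-K) * min ε 1) * (Real.exp (-K) * η) := by ring
    rw [e3]
    have : Real.exp (-K) * min ε 1 ≤ 1 := mul_le_one₀ hE1 hmin.le hm1
    nlinarith

lemma contraction {a h : V → V → ℝ → ℝ} (hW : Weights a) {d : V → ℝ → ℝ} (hd : Gains d)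
    (hU : ULI (Ahat a d)) (hA : AQSC (Ahat a d))
    {hbar : ℝ} (hh : Delays h hbar) (hbar0 : 0 ≤ hbar) :
    ∃ ρ T0 : ℝ, 0 ≤ ρ ∧ ρ < 1 ∧ ∀ tstar ≥ (0:ℝ), ∀ x : ℝ → V → ℝ,
      IsSolDamp a h d hbar tstar x → ∀ M ≥ (0:ℝ), ∀ τ ≥ tstar, τ ≥ T0 →
      (∀ s ≥ τ - hbar, ∀ j, x s j ≤ M) →
      ∃ τ' ≥ τ, ∀ s ≥ τ' - hbar, ∀ j, x s j ≤ ρ * M := by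
  obtain ⟨ε, hε, tp, htp, hbd, hq⟩ := hA
  obtain ⟨K, hK0, hK⟩ := exists_p hW hd hU htp hbd hbar0
  set δ := Real.exp (-K) * Real.exp (-K) * min ε 1 with hδ
  have hE := Real.exp_pos (-K)
  have hE1 : Real.exp (-K) ≤ 1 := Real.exp_le_one_iff.2 (by linarith)
  have hmin : 0 < min ε 1 := lt_min hε one_pos
  have hm1 : min ε 1 ≤ 1 := min_le_right _ _
  have hδ0 : 0 < δ := by positivity
  have hδ1 : δ ≤ 1 := mul_le_one₀ (mul_le_one₀ hE1 hE.le hE1) hmin.le hm1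
  have hpow : ∀ n : ℕ, δ ^ n ≤ 1 := fun n => pow_le_one₀ hδ0.le hδ1
  refine ⟨1 - Real.exp (-K) * δ ^ (Fintype.card V), tp 0, ?_, ?_, ?_⟩
  · have := mul_le_one₀ hE1 (by positivity) (hpow (Fintype.card V))
    linarith
  · have : 0 < Real.exp (-K) * δ ^ (Fintype.card V) := by positivity
    linarith
  intro tstar h0 x hx M hM τ h1 hT0 hle
  have claim : ∀ k ≤ Fintype.card V, ∃ τ' ≥ τ, ∃ R : Finset V, k ≤ R.card ∧
      ∀ i ∈ R, δ ^ k * M ≤ M - x τ' i := by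
    intro k
    induction k with
    | zero => exact fun _ => ⟨τ, le_rfl, ∅, by simp, by simp⟩
    | succ k ih =>
      intro hk
      obtain ⟨τ', hτ', R, hR, hgood⟩ := ih (by omega)
      obtain ⟨p, hp, hKp⟩ := hK τ' (le_trans hT0 hτ')
      have hmono : tp p ≤ tp (p+1) := htp.1.monotone (Nat.le_succ p)
      have hle' : ∀ s ≥ τ' - hbar, ∀ j, x s j ≤ M := fun s hs j => hle s (by linarith) j
      have hηM : δ ^ k * M ≤ M := by
        have := mul_le_mul_of_nonneg_right (hpow k) hM
        linarith
      by_cases hRu : R = Finset.univ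
      · refine ⟨τ', hτ', R, ?_, ?_⟩
        · rw [hRu, Finset.card_univ]; exact hk
        · intro i hi
          refine le_trans ?_ (hgood i hi)
          apply mul_le_mul_of_nonneg_right _ hM
          exact pow_le_pow_of_le_one hδ0.le hδ1 (Nat.le_succ k)
      · obtain ⟨i, hi, hall⟩ := stage hW hd h0 hh hbar0 hx hM (h1.trans hτ') hle' hε hK0 hp
          hmono hKp (hq p) R hRu (by positivity) hηM hgood
        refine ⟨tp (p+1), by linarith, insert i R, ?_, ?_⟩
        · rw [Finset.card_insert_of_notMem hi]; omega
        · intro j hj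
          have := hall j hj
          rw [← hδ] at this
          rw [pow_succ]
          linarith
  obtain ⟨τ', hτ', R, hR, hgood⟩ := claim _ le_rfl
  have hRu : R = Finset.univ := (Finset.card_eq_iff_eq_univ R).1
    (le_antisymm (Finset.card_le_univ R) hR)
  subst hRu
  obtain ⟨p, hp, hKp⟩ := hK τ' (le_trans hT0 hτ')
  have hmono : tp p ≤ tp (p+1) := htp.1.monotone (Nat.le_succ p)
  have hle' : ∀ s ≥ τ' - hbar, ∀ j, x s j ≤ M := fun s hs j => hle s (by linarith) j
  have h1' : tstar ≤ τ' := h1.trans hτ'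
  have hτ0 : 0 ≤ τ' := h0.trans h1'
  refine ⟨τ' + hbar, by linarith, ?_⟩
  have hwin : ∀ s ∈ Icc (τ' + hbar - hbar) (τ' + hbar), ∀ j,
      x s j ≤ (1 - Real.exp (-K) * δ ^ (Fintype.card V)) * M := by
    intro s hs j
    have hs1 : τ' ≤ s := by linarith [hs.1]
    have hKs : ∫ r in τ'..s, cc a d j r ≤ K :=
      (prim_mono hs1 (by linarith [hs.2]) (cc_ii hW hd j hτ0 (by linarith))
        (fun s hs => cc_nonneg hW hd j (hτ0.trans hs.1))).trans (hKp j)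
    have := keep hW hd h0 hh hx hM h1' hs1 hle' j hKs (fun _ => 0) (by simp)
      (by simp) (fun s hs => ff_nonneg hW hd hh hM (hτ0.trans hs.1) hs.1 hle' j) hbar0
    simp only [intervalIntegral.integral_zero, add_zero] at this
    have h3 := mul_le_mul_of_nonneg_left (hgood j (Finset.mem_univ j)) hE.le
    linarith
  have hρ : 0 ≤ 1 - Real.exp (-K) * δ ^ (Fintype.card V) := by
    have := mul_le_one₀ hE1 (by positivity) (hpow (Fintype.card V))
    linarith
  intro s hs j
  rcases le_total s (τ' + hbar) with hc | hc
  · exact hwin s ⟨hs, hc⟩ j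
  · exact max_principle hW hd h0 hh hx (mul_nonneg hρ hM) (by linarith) hwin s hc j

lemma eventually_le {a h : V → V → ℝ → ℝ} (hW : Weights a) {d : V → ℝ → ℝ} (hd : Gains d)
    (hU : ULI (Ahat a d)) (hA : AQSC (Ahat a d))
    {hbar : ℝ} (hh : Delays h hbar) (hbar0 : 0 ≤ hbar) {tstar : ℝ} (h0 : 0 ≤ tstar)
    {x : ℝ → V → ℝ} (hx : IsSolDamp a h d hbar tstar x) (e : ℝ) (he : 0 < e) :
    ∃ τ, ∀ s ≥ τ, ∀ j, x s j ≤ e := by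
  obtain ⟨ρ, T0, hρ0, hρ1, hcon⟩ := contraction hW hd hU hA hh hbar0
  obtain ⟨M, hM⟩ := hx.2.1
  have hall := max_principle hW hd h0 hh hx (abs_nonneg M) le_rfl
    (fun s hs j => (le_abs_self _).trans ((hM s hs j).trans (le_abs_self M)))
  have hit : ∀ k : ℕ, ∃ τ ≥ tstar, τ ≥ T0 ∧ ∀ s ≥ τ - hbar, ∀ j, x s j ≤ ρ ^ k * |M| := by
    intro k
    induction k with
    | zero =>
      refine ⟨max tstar T0 + hbar, ?_, ?_, ?_⟩
      · linarith [le_max_left tstar T0]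
      · linarith [le_max_right tstar T0]
      · intro s hs j
        rw [pow_zero, one_mul]
        exact hall s (by linarith [le_max_left tstar T0]) j
    | succ k ih =>
      obtain ⟨τ, h1, h2, h3⟩ := ih
      obtain ⟨τ', h4, h5⟩ := hcon tstar h0 x hx _ (mul_nonneg (pow_nonneg hρ0 k) (abs_nonneg M))
        τ h1 h2 h3
      refine ⟨τ', h1.trans h4, le_trans h2 h4, fun s hs j => ?_⟩
      have := h5 s hs j
      rw [pow_succ]
      linarith
  have hlim : Tendsto (fun k : ℕ => ρ ^ k * |M|) atTop (𝓝 0) := by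
    simpa using (tendsto_pow_atTop_nhds_zero_of_lt_one hρ0 hρ1).mul_const |M|
  obtain ⟨k, hk⟩ := (hlim.eventually_lt_const he).exists
  obtain ⟨τ, _, _, h3⟩ := hit k
  exact ⟨τ, fun s hs j => (h3 s (by linarith) j).trans hk.le⟩

lemma part_two {a h : V → V → ℝ → ℝ} (hW : Weights a) {d : V → ℝ → ℝ} (hd : Gains d)
    (hU : ULI (Ahat a d)) (hA : AQSC (Ahat a d))
    {hbar : ℝ} (hh : Delays h hbar) (hbar0 : 0 ≤ hbar) {tstar : ℝ} (h0 : 0 ≤ tstar)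
    {x : ℝ → V → ℝ} (hx : IsSolDamp a h d hbar tstar x) (i : V) :
    Tendsto (fun t => x t i) atTop (𝓝 0) := by
  rw [Metric.tendsto_atTop]
  intro e he
  obtain ⟨τ1, h1⟩ := eventually_le hW hd hU hA hh hbar0 h0 hx (e/2) (by linarith)
  obtain ⟨τ2, h2⟩ := eventually_le hW hd hU hA hh hbar0 h0 hx.neg (e/2) (by linarith)
  refine ⟨max τ1 τ2, fun t ht => ?_⟩
  have a1 := h1 t ((le_max_left _ _).trans ht) i
  have a2 := h2 t ((le_max_right _ _).trans ht) i
  rw [Real.dist_eq, sub_zero, abs_lt]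
  constructor <;> linarith

/-- Incoming term of node `i`. -/
def uu (a h : V → V → ℝ → ℝ) (X : ℝ → V → ℝ) (i : V) (s : ℝ) : ℝ :=
  ∑ j ∈ Finset.univ.erase i, a i j s * X (s - h i j s) j

/-- Mild-form Picard operator with constant initial data `1`. -/
noncomputable def Phi (a h : V → V → ℝ → ℝ) (d : V → ℝ → ℝ) (τ : ℝ) (X : ℝ → V → ℝ)
    (t : ℝ) (i : V) : ℝ :=
  Real.exp (∫ s in τ..(max τ t), (-cc a d i s)) *
    (1 + ∫ s in τ..(max τ t), Real.exp (∫ r in τ..s, cc a d i r) * uu a h X i s)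

/-- Measurable functions with values in `[0,1]`. -/
def Good (X : ℝ → V → ℝ) : Prop :=
  (∀ i, Measurable (fun t => X t i)) ∧ ∀ t i, 0 ≤ X t i ∧ X t i ≤ 1

section phi
variable {a h : V → V → ℝ → ℝ} {d : V → ℝ → ℝ} {hbar τ : ℝ} {X Y : ℝ → V → ℝ}

lemma uu_nonneg (hW : Weights a) (hX : Good X) (i : V) {s : ℝ} (hs : 0 ≤ s) :
    0 ≤ uu a h X i s :=
  Finset.sum_nonneg fun j hj => mul_nonneg (hW.nonneg hj hs) (hX.2 _ _).1

lemma uu_mono (hW : Weights a) (hXY : ∀ t i, X t i ≤ Y t i) (i : V) {s : ℝ} (hs : 0 ≤ s) :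
    uu a h X i s ≤ uu a h Y i s :=
  Finset.sum_le_sum fun j hj => mul_le_mul_of_nonneg_left (hXY _ _) (hW.nonneg hj hs)

lemma uu_le (hW : Weights a) (hd : Gains d) (hX : Good X) (i : V) {s : ℝ} (hs : 0 ≤ s) :
    uu a h X i s ≤ cc a d i s := by
  have h1 : uu a h X i s ≤ ∑ j ∈ Finset.univ.erase i, a i j s :=
    Finset.sum_le_sum fun j hj => by
      have := mul_le_mul_of_nonneg_left (hX.2 (s - h i j s) j).2 (hW.nonneg hj hs)
      linarith
  have h2 := (hd i).2.1 s hs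
  unfold cc
  linarith

lemma uu_meas (hW : Weights a) (hh : Delays h hbar) (hX : Good X) (i : V) :
    Measurable (uu a h X i) := by
  unfold uu
  apply Finset.measurable_sum
  intro j hj
  apply Measurable.mul (hW i j (Finset.ne_of_mem_erase hj).symm).1
  exact (hX.1 j).comp (measurable_id.sub (hh i j).1)

lemma uu_ii (hW : Weights a) (hd : Gains d) (hh : Delays h hbar) (hX : Good X) (i : V)
    (h0 : 0 ≤ τ) {T : ℝ} (hT : τ ≤ T) : IntervalIntegrable (uu a h X i) volume τ T := by
  apply (cc_ii hW hd i h0 hT).mono_fun' (uu_meas hW hh hX i).aestronglyMeasurable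
  rw [uIoc_of_le hT]
  filter_upwards [ae_restrict_mem measurableSet_Ioc] with s hs
  have hs0 : 0 ≤ s := h0.trans hs.1.le
  rw [Real.norm_of_nonneg (uu_nonneg hW hX i hs0)]
  exact uu_le hW hd hX i hs0

lemma expcc_cont (hW : Weights a) (hd : Gains d) (i : V)
    (h0 : 0 ≤ τ) {T : ℝ} (hT : τ ≤ T) :
    ContinuousOn (fun s => Real.exp (∫ r in τ..s, cc a d i r)) (uIcc τ T) :=
  Real.continuous_exp.comp_continuousOn (prim_continuousOn (cc_ii hW hd i h0 hT))

lemma expuu_ii (hW : Weights a) (hd : Gains d) (hh : Delays h hbar) (hX : Good X) (i : V)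
    (h0 : 0 ≤ τ) {T : ℝ} (hT : τ ≤ T) :
    IntervalIntegrable (fun s => Real.exp (∫ r in τ..s, cc a d i r) * uu a h X i s)
      volume τ T :=
  (uu_ii hW hd hh hX i h0 hT).continuousOn_mul (expcc_cont hW hd i h0 hT)

lemma expcc_ii (hW : Weights a) (hd : Gains d) (i : V)
    (h0 : 0 ≤ τ) {T : ℝ} (hT : τ ≤ T) :
    IntervalIntegrable (fun s => Real.exp (∫ r in τ..s, cc a d i r) * cc a d i s)
      volume τ T :=
  (cc_ii hW hd i h0 hT).continuousOn_mul (expcc_cont hW hd i h0 hT)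

lemma Phi_of_ge {t : ℝ} (ht : τ ≤ t) (i : V) : Phi a h d τ X t i =
    Real.exp (∫ s in τ..t, (-cc a d i s)) *
    (1 + ∫ s in τ..t, Real.exp (∫ r in τ..s, cc a d i r) * uu a h X i s) := by
  unfold Phi
  rw [max_eq_right ht]

lemma Phi_of_le {t : ℝ} (ht : t ≤ τ) (i : V) : Phi a h d τ X t i = 1 := by
  unfold Phi
  rw [max_eq_left ht]
  simp

lemma Phi_contOn (hW : Weights a) (hd : Gains d) (hh : Delays h hbar) (hX : Good X) (i : V)
    (h0 : 0 ≤ τ) {T : ℝ} (hT : τ ≤ T) :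
    ContinuousOn (fun t => Phi a h d τ X t i) (Icc τ T) := by
  have h1 := Real.continuous_exp.comp_continuousOn (prim_continuousOn (cc_ii hW hd i h0 hT).neg)
  have h2 := (prim_continuousOn (expuu_ii hW hd hh hX i h0 hT)).const_add 1
  have h3 := h1.mul h2
  rw [uIcc_of_le hT] at h3
  apply h3.congr
  intro t ht
  exact Phi_of_ge ht.1 i

lemma Phi_meas (hW : Weights a) (hd : Gains d) (hh : Delays h hbar) (hX : Good X) (i : V)
    (h0 : 0 ≤ τ) : Measurable (fun t => Phi a h d τ X t i) := by
  have h1 : ContinuousOn (fun t => Phi a h d τ X t i) (Ici τ) := by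
    intro t ht
    have ht' : τ ≤ t := ht
    have := Phi_contOn hW hd hh hX i h0 (T := t + 1) (by linarith) t ⟨ht', by linarith⟩
    apply this.mono_of_mem_nhdsWithin
    have : Iio (t+1) ∈ 𝓝 t := Iio_mem_nhds (by linarith)
    filter_upwards [self_mem_nhdsWithin, mem_nhdsWithin_of_mem_nhds this] with s hs1 hs2
    exact ⟨hs1, (show s < t + 1 from hs2).le⟩
  have h2 : Continuous (fun t => Phi a h d τ X (max τ t) i) :=
    h1.comp_continuous (continuous_const.max continuous_id) (fun t => mem_Ici.2 (le_max_left _ _))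
  have h3 : (fun t => Phi a h d τ X t i) = (fun t => Phi a h d τ X (max τ t) i) := by
    ext t; simp [Phi]
  rw [h3]
  exact h2.measurable

lemma Phi_mono (hW : Weights a) (hd : Gains d) (hh : Delays h hbar) (hX : Good X) (hY : Good Y)
    (h0 : 0 ≤ τ) (hXY : ∀ t i, X t i ≤ Y t i) (t : ℝ) (i : V) :
    Phi a h d τ X t i ≤ Phi a h d τ Y t i := by
  rcases le_total t τ with ht | ht
  · rw [Phi_of_le ht, Phi_of_le ht]
  rw [Phi_of_ge ht, Phi_of_ge ht]
  apply mul_le_mul_of_nonneg_left _ (Real.exp_pos _).le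
  apply add_le_add_right
  apply intervalIntegral.integral_mono_on ht (expuu_ii hW hd hh hX i h0 ht)
    (expuu_ii hW hd hh hY i h0 ht)
  intro s hs
  exact mul_le_mul_of_nonneg_left (uu_mono hW hXY i (h0.trans hs.1)) (Real.exp_pos _).le

lemma Phi_good (hW : Weights a) (hd : Gains d) (hh : Delays h hbar) (hX : Good X)
    (h0 : 0 ≤ τ) : Good (Phi a h d τ X) := by
  refine ⟨fun i => Phi_meas hW hd hh hX i h0, fun t i => ?_⟩
  rcases le_total t τ with ht | ht
  · rw [Phi_of_le ht]; norm_num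
  rw [Phi_of_ge ht]
  have e1 : 0 ≤ ∫ s in τ..t, Real.exp (∫ r in τ..s, cc a d i r) * uu a h X i s := by
    apply intervalIntegral.integral_nonneg ht
    intro s hs
    exact mul_nonneg (Real.exp_pos _).le (uu_nonneg hW hX i (h0.trans hs.1))
  have e2 : (∫ s in τ..t, Real.exp (∫ r in τ..s, cc a d i r) * uu a h X i s)
      ≤ ∫ s in τ..t, cc a d i s * Real.exp (∫ r in τ..s, cc a d i r) := by
    have := expcc_ii hW hd i h0 ht
    simp_rw [mul_comm (cc a d i _)]
    apply intervalIntegral.integral_mono_on ht (expuu_ii hW hd hh hX i h0 ht) this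
    intro s hs
    exact mul_le_mul_of_nonneg_left (uu_le hW hd hX i (h0.trans hs.1)) (Real.exp_pos _).le
  rw [exp_identity (cc_ii hW hd i h0 ht)] at e2
  rw [intervalIntegral.integral_neg]
  refine ⟨mul_nonneg (Real.exp_pos _).le (by linarith), ?_⟩
  have e3 := mul_le_mul_of_nonneg_left (show (1 + ∫ s in τ..t,
    Real.exp (∫ r in τ..s, cc a d i r) * uu a h X i s) ≤ Real.exp (∫ s in τ..t, cc a d i s) by
      linarith) (Real.exp_pos (-∫ s in τ..t, cc a d i s)).le
  rwa [← Real.exp_add, neg_add_cancel, Real.exp_zero] at e3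

lemma Phi_lin (hW : Weights a) (hd : Gains d) (hh : Delays h hbar) (hX : Good X) (i : V)
    (h0 : 0 ≤ τ) {T : ℝ} (hT : τ ≤ T) :
    LinSol (cc a d i) (uu a h X i) (fun t => Phi a h d τ X t i) τ T := by
  have hu := uu_ii hW hd hh hX i h0 hT
  refine ⟨hT, cc_ii hW hd i h0 hT, fun s hs => cc_nonneg hW hd i (h0.trans hs.1), hu, ?_, ?_⟩
  · apply IntervalIntegrable.add _ hu
    apply IntervalIntegrable.neg
    apply (cc_ii hW hd i h0 hT).mul_continuousOn
    rw [uIcc_of_le hT]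
    exact Phi_contOn hW hd hh hX i h0 hT
  · intro t ht
    have := prod_identity 1 (cc_ii hW hd i h0 ht.1).neg (expuu_ii hW hd hh hX i h0 ht.1)
    try simp only [Pi.neg_apply] at this
    try simp only
    rw [Phi_of_le le_rfl, Phi_of_ge ht.1, this]
    congr 1
    apply intervalIntegral.integral_congr
    intro s hs
    rw [uIcc_of_le ht.1] at hs
    try simp only
    rw [Phi_of_ge hs.1, mul_add, ← mul_assoc, ← Real.exp_add, intervalIntegral.integral_neg,
      neg_add_cancel, Real.exp_zero]
    ring

lemma Phi_low (hW : Weights a) (hd : Gains d) (hh : Delays h hbar) (hX : Good X)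
    (h0 : 0 ≤ τ) (S : Finset V) {g : ℝ → ℝ} (hg : ∀ T, τ ≤ T → IntervalIntegrable g volume τ T)
    (hg0 : ∀ s, 0 ≤ s → 0 ≤ g s)
    (hgS : ∀ s, 0 ≤ s → ∀ i ∈ S, d i s + ∑ j ∈ (Finset.univ.erase i) \ S, a i j s ≤ g s)
    (hlow : ∀ t, ∀ i ∈ S, 1 - ∫ s in τ..(max τ t), g s ≤ X t i) :
    ∀ t, ∀ i ∈ S, 1 - ∫ s in τ..(max τ t), g s ≤ Phi a h d τ X t i := by
  intro t i hi
  rcases le_total t τ with ht | ht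
  · rw [Phi_of_le ht, max_eq_left ht]; simp
  rw [max_eq_right ht]
  have L := Phi_lin hW hd hh hX i h0 ht
  have hgi := hg t ht
  have hG : ContinuousOn (fun t => ∫ s in τ..t, g s) (uIcc τ t) := prim_continuousOn hgi
  have hcG : IntervalIntegrable (fun s => cc a d i s * (1 - ∫ r in τ..s, g r)) volume τ t :=
    L.hc.mul_continuousOn (continuousOn_const.sub hG)
  have key : ∀ s, -(cc a d i s * (Phi a h d τ X s i - 1 + ∫ r in τ..s, g r)) +
      (uu a h X i s + g s - cc a d i s * (1 - ∫ r in τ..s, g r))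
      = (-(cc a d i s * Phi a h d τ X s i) + uu a h X i s) + g s := by
    intro s; ring
  have L2 : LinSol (cc a d i) (fun s => uu a h X i s + g s - cc a d i s * (1 - ∫ r in τ..s, g r))
      (fun s => Phi a h d τ X s i - 1 + ∫ r in τ..s, g r) τ t := by
    refine ⟨ht, L.hc, L.hc0, (L.hf.add hgi).sub hcG, ?_, ?_⟩
    · simp_rw [key]; exact L.hcy.add hgi
    · intro r hr
      simp_rw [key]
      have hsub : uIcc τ r ⊆ uIcc τ t := by
        rw [uIcc_of_le hr.1, uIcc_of_le ht]; exact Icc_subset_Icc_right hr.2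
      rw [intervalIntegral.integral_add (L.hcy.mono_set hsub) (hgi.mono_set hsub), L.eq r hr]
      simp
      ring
  have := L2.lower (g := fun _ => 0) (by simp) (fun _ _ => le_rfl) ?_
  · simp [Phi_of_le (le_refl τ)] at this
    linarith
  intro s hs
  have hs0 : 0 ≤ s := h0.trans hs.1
  set G := ∫ r in τ..s, g r with hGd
  have hG0 : 0 ≤ G := intervalIntegral.integral_nonneg hs.1 fun r hr => hg0 r (h0.trans hr.1)
  have hterm : ∀ j ∈ Finset.univ.erase i,
      -(if j ∈ S then 0 else a i j s) ≤ a i j s * X (s - h i j s) j - a i j s * (1 - G) := by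
    intro j hj
    have ha := hW.nonneg hj hs0
    split_ifs with hjS
    · have h1 := hlow (s - h i j s) j hjS
      have h2 : ∫ r in τ..(max τ (s - h i j s)), g r ≤ G := by
        apply prim_mono (le_max_left _ _) (max_le hs.1 _) (hg s hs.1)
          (fun r hr => hg0 r (h0.trans hr.1))
        linarith [((hh i j).2 s hs0).1]
      have := mul_nonneg ha (show 0 ≤ X (s - h i j s) j - (1 - G) by linarith)
      linarith
    · have h1 := mul_nonneg ha (hX.2 (s - h i j s) j).1
      have h2 := mul_nonneg ha hG0
      linarith
  have hsum := Finset.sum_le_sum hterm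
  rw [Finset.sum_sub_distrib, Finset.sum_neg_distrib, ← Finset.sum_mul] at hsum
  have e : ∑ j ∈ Finset.univ.erase i, (if j ∈ S then 0 else a i j s)
      = ∑ j ∈ (Finset.univ.erase i) \ S, a i j s := by
    rw [Finset.sdiff_eq_filter, Finset.sum_filter]
    apply Finset.sum_congr rfl
    intro j _
    split_ifs <;> simp_all
  rw [e] at hsum
  have hgs := hgS s hs0 i hi
  have hd0 := mul_nonneg ((hd i).2.1 s hs0) hG0
  have : cc a d i s = d i s + ∑ j ∈ Finset.univ.erase i, a i j s := rfl
  simp only [this, uu]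
  linarith

lemma exists_sol (hW : Weights a) (hd : Gains d) (hh : Delays h hbar)
    (h0 : 0 ≤ τ) (S : Finset V) {g : ℝ → ℝ} (hg : ∀ T, τ ≤ T → IntervalIntegrable g volume τ T)
    (hg0 : ∀ s, 0 ≤ s → 0 ≤ g s)
    (hgS : ∀ s, 0 ≤ s → ∀ i ∈ S, d i s + ∑ j ∈ (Finset.univ.erase i) \ S, a i j s ≤ g s) :
    ∃ x : ℝ → V → ℝ, IsSolDamp a h d hbar τ x ∧
      ∀ t, ∀ i ∈ S, 1 - ∫ s in τ..(max τ t), g s ≤ x t i := by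
  set P := Phi a h d τ with hP
  set Xn : ℕ → ℝ → V → ℝ := fun n => P^[n] (fun _ _ => 1) with hXn
  have hsucc : ∀ n, Xn (n+1) = P (Xn n) := fun n => Function.iterate_succ_apply' _ _ _
  have hgood : ∀ n, Good (Xn n) := by
    intro n
    induction n with
    | zero => exact ⟨fun i => measurable_const, fun t i => by simp [hXn]⟩
    | succ n ih => rw [hsucc]; exact Phi_good hW hd hh ih h0
  have hlow : ∀ n, ∀ t, ∀ i ∈ S, 1 - ∫ s in τ..(max τ t), g s ≤ Xn n t i := by
    intro n
    induction n with
    | zero =>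
      intro t i _
      have : 0 ≤ ∫ s in τ..(max τ t), g s :=
        intervalIntegral.integral_nonneg (le_max_left _ _) fun r hr => hg0 r (h0.trans hr.1)
      simp [hXn]; linarith
    | succ n ih => rw [hsucc]; exact Phi_low hW hd hh (hgood n) h0 S hg hg0 hgS ih
  have hstep : ∀ n t i, Xn (n+1) t i ≤ Xn n t i := by
    intro n
    induction n with
    | zero => intro t i; exact ((hgood 1).2 t i).2
    | succ n ih =>
      intro t i
      rw [hsucc (n+1), hsucc n]
      exact Phi_mono hW hd hh (by rw [← hsucc]; exact hgood (n+1)) (hgood n) h0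
        (by rw [← hsucc]; exact ih) t i
  set x : ℝ → V → ℝ := fun t i => ⨅ n, Xn n t i with hx
  have hlim : ∀ t i, Tendsto (fun n => Xn n t i) atTop (𝓝 (x t i)) := by
    intro t i
    apply tendsto_atTop_ciInf (antitone_nat_of_succ_le fun n => hstep n t i)
    exact ⟨0, by rintro _ ⟨n, rfl⟩; exact ((hgood n).2 t i).1⟩
  have hxg : Good x := by
    refine ⟨fun i => ?_, fun t i => ⟨?_, ?_⟩⟩
    · exact measurable_of_tendsto_metrizable (fun n => (hgood n).1 i)
        (tendsto_pi_nhds.2 fun t => hlim t i)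
    · exact ge_of_tendsto' (hlim t i) fun n => ((hgood n).2 t i).1
    · exact le_of_tendsto' (hlim t i) fun n => ((hgood n).2 t i).2
  have hfix : ∀ t i, P x t i = x t i := by
    intro t i
    have h1 : Tendsto (fun n => P (Xn n) t i) atTop (𝓝 (P x t i)) := by
      simp only [hP, Phi]
      apply Tendsto.const_mul
      apply Tendsto.const_add
      have hm : τ ≤ max τ t := le_max_left _ _
      apply intervalIntegral.tendsto_integral_filter_of_dominated_convergence
        (fun s => Real.exp (∫ r in τ..s, cc a d i r) * cc a d i s)
      · apply Eventually.of_forall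
        intro n
        have := (expuu_ii hW hd hh (hgood n) i h0 hm).aestronglyMeasurable
        rwa [uIoc_of_le hm]
      · apply Eventually.of_forall
        intro n
        apply Eventually.of_forall
        intro s hs
        rw [uIoc_of_le hm] at hs
        have hs0 : 0 ≤ s := h0.trans hs.1.le
        rw [Real.norm_of_nonneg (mul_nonneg (Real.exp_pos _).le (uu_nonneg hW (hgood n) i hs0))]
        exact mul_le_mul_of_nonneg_left (uu_le hW hd (hgood n) i hs0) (Real.exp_pos _).le
      · exact expcc_ii hW hd i h0 hm
      · apply Eventually.of_forall
        intro s hs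
        apply Tendsto.const_mul
        unfold uu
        apply tendsto_finsetSum
        intro j _
        exact (hlim _ _).const_mul _
    have h2 : Tendsto (fun n => P (Xn n) t i) atTop (𝓝 (x t i)) := by
      have := (tendsto_add_atTop_iff_nat 1).2 (hlim t i)
      simpa only [hsucc] using this
    exact tendsto_nhds_unique h1 h2
  refine ⟨x, ⟨fun i => (hxg.1 i).aestronglyMeasurable, ⟨1, fun s _ i => ?_⟩, ?_⟩, ?_⟩
  · rw [abs_of_nonneg (hxg.2 s i).1]; exact (hxg.2 s i).2
  · intro i t ht
    have L := Phi_lin hW hd hh hxg i h0 ht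
    have e1 : (fun t => Phi a h d τ x t i) = fun t => x t i := by
      ext t; exact hfix t i
    rw [e1] at L
    have e2 : rhsDamp a h d x i = fun s => -(cc a d i s * x s i) + uu a h x i s := by
      ext s
      simp only [cc, uu, rhsDamp, mul_sub, Finset.sum_sub_distrib, ← Finset.sum_mul]
      ring
    rw [e2]
    exact ⟨L.hcy, L.eq t ⟨ht, le_rfl⟩⟩
  · intro t i hi
    exact ge_of_tendsto' (hlim t i) fun n => hlow n t i hi

end phi

lemma integrable_of_not_top {f : ℝ → ℝ} (hm : Measurable f) (h0 : ∀ t ≥ (0:ℝ), 0 ≤ f t)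
    (hf : (∫⁻ t in Ioi (0:ℝ), ENNReal.ofReal (f t)) ≠ ⊤) : IntegrableOn f (Ioi 0) := by
  refine ⟨hm.aestronglyMeasurable, ?_⟩
  rw [hasFiniteIntegral_iff_ofReal]
  · exact lt_top_iff_ne_top.2 hf
  · filter_upwards [ae_restrict_mem measurableSet_Ioi] with s hs
    exact h0 s (le_of_lt hs)

lemma part_one {a : V → V → ℝ → ℝ} (hW : Weights a) {d : V → ℝ → ℝ} (hd : Gains d)
    {hbar : ℝ} {h : V → V → ℝ → ℝ} (hh : Delays h hbar)
    (hst : ∀ tstar ≥ (0:ℝ), ∀ x : ℝ → V → ℝ, IsSolDamp a h d hbar tstar x →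
        ∀ i : V, Tendsto (fun t => x t i) atTop (𝓝 0)) :
    QSCrel (fun u v : Option V => PArc (Ahat a d) u v) := by
  classical
  refine ⟨none, ?_⟩
  by_contra hcon
  push Not at hcon
  obtain ⟨o, ho⟩ := hcon
  cases o with
  | none => exact ho Relation.ReflTransGen.refl
  | some i0 =>
  set R := Relation.ReflTransGen (fun u v : Option V => PArc (Ahat a d) u v) none with hR
  set S : Finset V := Finset.univ.filter (fun i => ¬ R (some i)) with hS
  have hi0 : i0 ∈ S := by simp [hS, ho]
  have hdI : ∀ i ∈ S, IntegrableOn (d i) (Ioi 0) := by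
    intro i hi
    apply integrable_of_not_top (hd i).1 (hd i).2.1
    intro htop
    have : ¬ R (some i) := by simpa [hS] using hi
    exact this (Relation.ReflTransGen.single ⟨by simp, htop⟩)
  have haI : ∀ i ∈ S, ∀ j ∈ (Finset.univ.erase i) \ S, IntegrableOn (a i j) (Ioi 0) := by
    intro i hi j hj
    rw [Finset.mem_sdiff] at hj
    have hne := (Finset.ne_of_mem_erase hj.1)
    apply integrable_of_not_top (hW i j hne.symm).1 (hW i j hne.symm).2.1
    intro htop
    have h1 : ¬ R (some i) := by simpa [hS] using hi
    have h2 : R (some j) := by simpa [hS] using hj.2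
    exact h1 (h2.tail ⟨by simpa using hne, htop⟩)
  set q : V → ℝ → ℝ := fun i s => d i s + ∑ j ∈ (Finset.univ.erase i) \ S, a i j s with hq
  have hqI : ∀ i ∈ S, IntegrableOn (q i) (Ioi 0) := by
    intro i hi
    exact (hdI i hi).add (integrable_finsetSum _ fun j hj => haI i hi j hj)
  have hq0 : ∀ i, ∀ s, 0 ≤ s → 0 ≤ q i s := by
    intro i s hs
    exact add_nonneg ((hd i).2.1 s hs) (Finset.sum_nonneg fun j hj =>
      hW.nonneg (Finset.mem_sdiff.1 hj).1 hs)
  set g : ℝ → ℝ := fun s => ∑ i ∈ S, q i s with hgd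
  have hgI : IntegrableOn g (Ioi 0) := integrable_finsetSum _ hqI
  have hg0 : ∀ s, 0 ≤ s → 0 ≤ g s := fun s hs => Finset.sum_nonneg fun i _ => hq0 i s hs
  have hgii : ∀ τ T, 0 ≤ τ → τ ≤ T → IntervalIntegrable g volume τ T := by
    intro τ T h1 h2
    rw [intervalIntegrable_iff_integrableOn_Ioc_of_le h2]
    exact hgI.mono_set fun s hs => lt_of_le_of_lt h1 hs.1
  have hT := intervalIntegral_tendsto_integral_Ioi 0 hgI tendsto_id
  set I := ∫ s in Ioi 0, g s with hI
  have hIle : ∀ T, 0 ≤ T → ∫ s in (0:ℝ)..T, g s ≤ I := by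
    intro T hT0
    apply ge_of_tendsto hT
    filter_upwards [eventually_ge_atTop T] with T' hT'
    exact prim_mono hT0 hT' (hgii 0 T' le_rfl (hT0.trans hT'))
      fun r hr => hg0 r hr.1
  obtain ⟨τ, hτ1, hτ0⟩ := ((hT.eventually (lt_mem_nhds (show I - 1/2 < I by linarith))).and
    (eventually_ge_atTop 0)).exists
  simp only [id] at hτ1
  obtain ⟨x, hx, hlow⟩ := exists_sol (τ := τ) (g := g) hW hd hh hτ0 S
    (fun T h => hgii τ T hτ0 h) hg0
    (fun s hs i hi => Finset.single_le_sum (f := fun i => q i s) (fun i _ => hq0 i s hs) hi)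
  have hlim := hst τ hτ0 x hx i0
  have : (1/2 : ℝ) ≤ 0 := by
    apply ge_of_tendsto hlim
    filter_upwards [eventually_ge_atTop τ] with t ht
    have h1 := hlow t i0 hi0
    rw [max_eq_right ht] at h1
    have h2 := intervalIntegral.integral_add_adjacent_intervals (hgii 0 τ le_rfl hτ0)
      (hgii τ t hτ0 ht)
    have h3 := hIle t (hτ0.trans ht)
    linarith
  norm_num at this

theorem stmt13
    (a : V → V → ℝ → ℝ) (hW : Weights a)
    (d : V → ℝ → ℝ) (hd : Gains d) :
    (∀ hbar ≥ (0:ℝ), ∀ h : V → V → ℝ → ℝ, Delays h hbar →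
      (∀ tstar ≥ (0:ℝ), ∀ x : ℝ → V → ℝ, IsSolDamp a h d hbar tstar x →
        ∀ i : V, Tendsto (fun t => x t i) atTop (𝓝 0)) →
      QSCrel (fun u v : Option V => PArc (Ahat a d) u v)) ∧
    (ULI (Ahat a d) → AQSC (Ahat a d) →
      ∀ hbar ≥ (0:ℝ), ∀ h : V → V → ℝ → ℝ, Delays h hbar →
        ∀ tstar ≥ (0:ℝ), ∀ x : ℝ → V → ℝ, IsSolDamp a h d hbar tstar x →
          ∀ i : V, Tendsto (fun t => x t i) atTop (𝓝 0)) := by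
  exact ⟨fun _ _ _ hh hst => part_one hW hd hh hst,
    fun hU hA _ hb _ hh _ h0 _ hx i => part_two hW hd hU hA hh hb h0 hx i⟩
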